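/- For every integer L ≥ 1, the following truncation of Gauss' square exponent theorem holds in ℚ(q): ∑_{k=-L}^{L} (-1)^k q^{k^2} (-q;q)_{L-k} [3L-k+1 choose L+k]_q · (1-q^{4L+1})/(1-q^{3L-k+1}) = 1. -/

import Mathlib

open Finset

/-- The indeterminate `q`, as an element of the field `ℚ(q)` of rational functions. -/
noncomputable def q : RatFunc ℚ := RatFunc.X

/-- The q-Pochhammer symbol `(a; q)_n` for a nonnegative integer `n`. -/
noncomputable def qPoch (a : RatFunc ℚ) (n : ℕ) : RatFunc ℚ :=
  ∏ k ∈ Finset.range n, (1 - a * q ^ k)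

/-- The q-Pochhammer symbol `(a; q)_n` for an arbitrary integer `n`, where for `n > 0`
`(a; q)_{-n} = 1 / (a q^{-n}; q)_n`. -/
noncomputable def qPochZ (a : RatFunc ℚ) (n : ℤ) : RatFunc ℚ :=
  if 0 ≤ n then qPoch a n.toNat else 1 / qPoch (a * q ^ n) (-n).toNat

/-- The Gaussian (q-)binomial coefficient `[n choose m]_q`, equal to
`(q;q)_n / ((q;q)_m (q;q)_{n-m})` for `0 ≤ m ≤ n` and `0` otherwise. -/
noncomputable def qbinom (n m : ℤ) : RatFunc ℚ :=
  if 0 ≤ m ∧ m ≤ n then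
    qPoch q n.toNat / (qPoch q m.toNat * qPoch q (n - m).toNat)
  else 0

lemma q_ne_zero : q ≠ 0 := RatFunc.X_ne_zero

lemma q_pow_ne_one {n : ℕ} (hn : n ≠ 0) : q ^ n ≠ 1 := by
  intro h
  have h' : algebraMap (Polynomial ℚ) (RatFunc ℚ) (Polynomial.X ^ n) =
      algebraMap (Polynomial ℚ) (RatFunc ℚ) 1 := by
    simpa [q, RatFunc.algebraMap_X] using h
  have h'' := congrArg Polynomial.natDegree (RatFunc.algebraMap_injective ℚ h')
  simp at h''
  exact hn h''

lemma one_sub_q_pow_ne_zero {n : ℕ} (hn : n ≠ 0) : 1 - q ^ n ≠ 0 :=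
  sub_ne_zero.mpr (q_pow_ne_one hn).symm

lemma one_add_q_pow_ne_zero {n : ℕ} (hn : n ≠ 0) : 1 + q ^ n ≠ 0 := by
  intro h
  apply one_sub_q_pow_ne_zero (n := 2 * n) (by omega)
  have : 1 - q ^ (2 * n) = (1 + q ^ n) * (1 - q ^ n) := by ring
  rw [this, h, zero_mul]

lemma qPoch_succ (a : RatFunc ℚ) (n : ℕ) :
    qPoch a (n + 1) = qPoch a n * (1 - a * q ^ n) := Finset.prod_range_succ _ _

lemma qPoch_q_succ (n : ℕ) : qPoch q (n + 1) = qPoch q n * (1 - q ^ (n + 1)) := by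
  rw [qPoch_succ, pow_succ']

lemma qPoch_q_ne_zero (n : ℕ) : qPoch q n ≠ 0 := by
  induction n with
  | zero => simp [qPoch]
  | succ n ih => rw [qPoch_q_succ]; exact mul_ne_zero ih (one_sub_q_pow_ne_zero (by omega))

/-- The product `(q; q²)_n`. -/
noncomputable def oddPoch (n : ℕ) : RatFunc ℚ :=
  ∏ k ∈ Finset.range n, (1 - q ^ (2 * k + 1))

lemma oddPoch_succ (n : ℕ) : oddPoch (n + 1) = oddPoch n * (1 - q ^ (2 * n + 1)) :=
  Finset.prod_range_succ _ _

lemma oddPoch_ne_zero (n : ℕ) : oddPoch n ≠ 0 :=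
  Finset.prod_ne_zero_iff.mpr fun _ _ => one_sub_q_pow_ne_zero (by omega)

lemma qPoch_two_mul_add_one (n : ℕ) :
    qPoch q (2 * n + 1) = qPoch (-q) n * qPoch q n * oddPoch (n + 1) := by
  induction n with
  | zero => simp [qPoch, oddPoch]
  | succ n ih =>
    rw [show 2 * (n + 1) + 1 = 2 * n + 1 + 1 + 1 by ring, qPoch_q_succ, qPoch_q_succ, ih,
      qPoch_succ (-q), qPoch_q_succ n, oddPoch_succ (n + 1)]
    ring

/-- The summand of the truncated Gauss sum, without the factor `1 - q^(2N+1)` and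
up to a monomial. -/
noncomputable def gaussTerm (N i : ℕ) : RatFunc ℚ :=
  if i ≤ N then
    (-1) ^ (N + i) * q ^ i ^ 2 / q ^ (N * i) * qPoch q (N + i) /
      (qPoch q (N - i) * qPoch q i * oddPoch (i + 1))
  else 0

/-- A common divisor of `gaussTerm N i`, `gaussTerm (N + 1) i` and `gaussTerm (N + 2) i`. -/
noncomputable def gaussCore (N i : ℕ) : RatFunc ℚ :=
  (-1) ^ (N + i) * q ^ i ^ 2 / (q ^ (N * i) * q ^ (2 * i)) * qPoch q (N + i) /
    (qPoch q (N + 2 - i) * qPoch q i * oddPoch (i + 1))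

lemma gaussTerm_add_two {N i : ℕ} (hi : i ≤ N + 2) :
    gaussTerm (N + 2) i =
      (1 - q * q ^ N * q ^ i) * (1 - q ^ 2 * q ^ N * q ^ i) * gaussCore N i := by
  rw [gaussTerm, if_pos hi, gaussCore, show N + 2 + i = N + i + 1 + 1 by ring, qPoch_q_succ,
    qPoch_q_succ]
  rw [show (N + 2) * i = N * i + 2 * i by ring, pow_add q (N * i)]
  ring

lemma gaussTerm_add_one {N i : ℕ} (hi : i ≤ N + 2) :
    gaussTerm (N + 1) i =
      -(1 - q * q ^ N * q ^ i) * (q ^ i - q ^ 2 * q ^ N) * gaussCore N i := by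
  rcases Nat.lt_or_ge (N + 1) i with h | h
  · obtain rfl : i = N + 2 := by omega
    rw [gaussTerm, if_neg (by omega)]
    ring
  · obtain ⟨d, hd⟩ := Nat.exists_eq_add_of_le h
    have h1 : N + 1 - i = d := by omega
    have h2 : N + 2 - i = d + 1 := by omega
    have hx : q ^ 2 * q ^ N = q ^ i * q ^ (d + 1) := by
      rw [← pow_add, ← pow_add]; congr 1; omega
    rw [gaussTerm, if_pos h, gaussCore, h1, h2, hx, show N + 1 + i = N + i + 1 by ring,
      qPoch_q_succ, qPoch_q_succ d, show (N + 1) * i = N * i + i by ring, pow_add q (N * i),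
      show 2 * i = i + i by ring, pow_add q i i]
    have := q_ne_zero
    have := one_sub_q_pow_ne_zero (n := d + 1) (by omega)
    have := qPoch_q_ne_zero d
    have := qPoch_q_ne_zero i
    have := oddPoch_ne_zero (i + 1)
    have hp : q ^ (N + i + 1) = q * q ^ N * q ^ i := by ring
    rw [hp]
    generalize q ^ (d + 1) = D at *
    field_simp
    ring

lemma gaussTerm_eq {N i : ℕ} (hi : i ≤ N + 2) :
    gaussTerm N i =
      (q ^ i - q * q ^ N) * (q ^ i - q ^ 2 * q ^ N) * gaussCore N i := by
  rcases Nat.lt_or_ge N i with h | h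
  · rw [gaussTerm, if_neg (by omega)]
    obtain rfl | rfl : i = N + 1 ∨ i = N + 2 := by omega
    all_goals ring
  · obtain ⟨d, hd⟩ := Nat.exists_eq_add_of_le h
    have h1 : N - i = d := by omega
    have h2 : N + 2 - i = d + 1 + 1 := by omega
    have hx : q ^ 2 * q ^ N = q ^ i * q ^ (d + 1 + 1) := by
      rw [← pow_add, ← pow_add]; congr 1; omega
    have hx' : q * q ^ N = q ^ i * q ^ (d + 1) := by
      rw [← pow_succ', ← pow_add]; congr 1; omega
    rw [gaussTerm, if_pos h, gaussCore, h1, h2, hx, hx',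
      qPoch_q_succ, qPoch_q_succ d, show 2 * i = i + i by ring, pow_add q i i]
    have := q_ne_zero
    have := one_sub_q_pow_ne_zero (n := d + 1) (by omega)
    have := one_sub_q_pow_ne_zero (n := d + 1 + 1) (by omega)
    have := qPoch_q_ne_zero d
    have := qPoch_q_ne_zero i
    have := oddPoch_ne_zero (i + 1)
    generalize q ^ (d + 1) = D at *
    generalize q ^ (d + 1 + 1) = D' at *
    field_simp

lemma gaussCore_succ {N i : ℕ} (hi : i ≤ N + 1) :
    q * q ^ N * (1 - q * q ^ i) * (1 - q ^ 3 * (q ^ i) ^ 2) * gaussCore N (i + 1) =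
      -(q ^ i * (1 - q * q ^ N * q ^ i) * (q ^ i - q ^ 2 * q ^ N)) * gaussCore N i := by
  obtain ⟨d, hd⟩ := Nat.exists_eq_add_of_le hi
  have h1 : N + 2 - (i + 1) = d := by omega
  have h2 : N + 2 - i = d + 1 := by omega
  have hx : q ^ 2 * q ^ N = q ^ i * q ^ (d + 1) := by
    rw [← pow_add, ← pow_add]; congr 1; omega
  have h3 : 1 - q * q ^ i ≠ 0 := by
    rw [← pow_succ']; exact one_sub_q_pow_ne_zero (by omega)
  have h4 : 1 - q ^ 3 * (q ^ i) ^ 2 ≠ 0 := by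
    rw [← pow_mul, ← pow_add]; exact one_sub_q_pow_ne_zero (by omega)
  rw [gaussCore, gaussCore, h1, h2, hx, ← add_assoc, qPoch_q_succ, qPoch_q_succ d,
    qPoch_q_succ i, oddPoch_succ (i + 1),
    show q ^ (2 * (i + 1) + 1) = q ^ 3 * (q ^ i) ^ 2 by ring,
    show q ^ (i + 1) = q * q ^ i by ring,
    show q ^ (N + i + 1) = q * q ^ N * q ^ i by ring,
    show q ^ (N * (i + 1)) = q ^ (N * i) * q ^ N by ring,
    show q ^ (2 * (i + 1)) = q ^ (2 * i) * q ^ 2 by ring,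
    show q ^ (i + 1) ^ 2 = q ^ i ^ 2 * (q ^ i) ^ 2 * q by ring,
    pow_succ (-1 : RatFunc ℚ)]
  have := q_ne_zero
  have := one_sub_q_pow_ne_zero (n := d + 1) (by omega)
  have := qPoch_q_ne_zero d
  have := qPoch_q_ne_zero i
  have := oddPoch_ne_zero (i + 1)
  generalize q ^ (d + 1) = D at *
  have hx0 : q ^ N ≠ 0 := pow_ne_zero _ q_ne_zero
  have hz0 : q ^ i ≠ 0 := pow_ne_zero _ q_ne_zero
  have : q ^ (N * i) ≠ 0 := pow_ne_zero _ q_ne_zero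
  have : q ^ (2 * i) ≠ 0 := pow_ne_zero _ q_ne_zero
  generalize q ^ N = x at *
  generalize q ^ (N * i) = u at *
  generalize q ^ (2 * i) = v at *
  generalize q ^ i ^ 2 = w at *
  generalize q ^ i = z at *
  field_simp

/-- The summand whose telescoping yields the recurrence for `truncGaussSum`. -/
noncomputable def gaussRecTerm (N i : ℕ) : RatFunc ℚ :=
  q * q ^ N * (1 + q ^ 3 * (q ^ N) ^ 3) * ((1 - q ^ 5 * (q ^ N) ^ 2) * gaussTerm (N + 2) i) -
    q * (q ^ N) ^ 2 * (1 - q ^ 3) * ((1 - q ^ 3 * (q ^ N) ^ 2) * gaussTerm (N + 1) i) +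
    (1 + q ^ 6 * (q ^ N) ^ 3) * ((1 - q * (q ^ N) ^ 2) * gaussTerm N i)

lemma sum_gaussRecTerm (N n : ℕ) (hn : n ≤ N + 2) :
    ∑ i ∈ Finset.range (n + 1), gaussRecTerm N i =
      (1 - q ^ 3 * (q ^ N) ^ 2) * (1 + q * q ^ N) * (1 + q ^ 2 * q ^ N) *
        (q ^ n * (1 - q * q ^ N * q ^ n) * (q ^ n - q ^ 2 * q ^ N)) *
        (1 - q * q ^ N + q ^ 3 * (q ^ N) ^ 2 + q ^ N * (1 - q) * (q * q ^ n)) *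
        gaussCore N n := by
  induction n with
  | zero =>
    rw [Finset.sum_range_one, gaussRecTerm, gaussTerm_add_two hn, gaussTerm_add_one hn,
      gaussTerm_eq hn]
    ring
  | succ n ih =>
    rw [Finset.sum_range_succ, ih (by omega), gaussRecTerm, gaussTerm_add_two hn,
      gaussTerm_add_one hn, gaussTerm_eq hn, pow_succ' q n]
    have h := gaussCore_succ (N := N) (i := n) (by omega)
    generalize gaussCore N (n + 1) = H' at *
    generalize gaussCore N n = H at *
    generalize q ^ N = x at *
    generalize q ^ n = z at *
    linear_combination
      ((1 - q ^ 3 * x ^ 2) * (1 + q * x) * (1 + q ^ 2 * x) *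
        (1 - q * x + q ^ 3 * x ^ 2 + x * (1 - q) * (q * z))) * h

/-- The truncated Gauss sum, up to a monomial. -/
noncomputable def truncGaussSum (N : ℕ) : RatFunc ℚ :=
  ∑ i ∈ Finset.range (N + 1), (1 - q * (q ^ N) ^ 2) * gaussTerm N i

lemma truncGaussSum_eq_sum_range {N M : ℕ} (h : N + 1 ≤ M) :
    truncGaussSum N = ∑ i ∈ Finset.range M, (1 - q * (q ^ N) ^ 2) * gaussTerm N i := by
  refine Finset.sum_subset (Finset.range_subset_range.mpr h) fun i _ hi => ?_
  rw [Finset.mem_range] at hi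
  rw [gaussTerm, if_neg (by omega), mul_zero]

lemma truncGaussSum_recurrence (N : ℕ) :
    q * q ^ N * (1 + q ^ 3 * (q ^ N) ^ 3) * truncGaussSum (N + 2) -
      q * (q ^ N) ^ 2 * (1 - q ^ 3) * truncGaussSum (N + 1) +
      (1 + q ^ 6 * (q ^ N) ^ 3) * truncGaussSum N = 0 := by
  have h := sum_gaussRecTerm N (N + 2) le_rfl
  rw [show q ^ (N + 2) - q ^ 2 * q ^ N = 0 by ring] at h
  simp only [gaussRecTerm, Finset.sum_add_distrib, Finset.sum_sub_distrib,
    ← Finset.mul_sum _ _ (q * q ^ N * (1 + q ^ 3 * (q ^ N) ^ 3)),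
    ← Finset.mul_sum _ _ (q * (q ^ N) ^ 2 * (1 - q ^ 3)),
    ← Finset.mul_sum _ _ (1 + q ^ 6 * (q ^ N) ^ 3)] at h
  rw [truncGaussSum_eq_sum_range (N := N) (M := N + 2 + 1) (by omega),
    truncGaussSum_eq_sum_range (N := N + 1) (M := N + 2 + 1) (by omega),
    truncGaussSum_eq_sum_range (N := N + 2) (M := N + 2 + 1) le_rfl,
    show q * (q ^ (N + 2)) ^ 2 = q ^ 5 * (q ^ N) ^ 2 by ring,
    show q * (q ^ (N + 1)) ^ 2 = q ^ 3 * (q ^ N) ^ 2 by ring, h]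
  ring

lemma truncGaussSum_values (L : ℕ) :
    q ^ L ^ 2 * truncGaussSum (2 * L) = (-1) ^ L ∧
      q ^ L ^ 2 * truncGaussSum (2 * L + 1) = -(-1) ^ L * (q ^ (2 * L) * q ^ 2) := by
  have hq := q_ne_zero
  have h1 : 1 - q ≠ 0 := by simpa using one_sub_q_pow_ne_zero one_ne_zero
  induction L with
  | zero =>
    have h3 : 1 - q ^ 3 ≠ 0 := one_sub_q_pow_ne_zero (by norm_num)
    refine ⟨?_, ?_⟩
    · simp [truncGaussSum, gaussTerm, qPoch, oddPoch, h1]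
    · simp [truncGaussSum, gaussTerm, qPoch, oddPoch, Finset.sum_range_succ, Finset.prod_range_succ]
      field_simp
      ring
  | succ L ih =>
    obtain ⟨he, ho⟩ := ih
    have hr := truncGaussSum_recurrence (2 * L)
    have hr' := truncGaussSum_recurrence (2 * L + 1)
    have hn : 1 + q ^ 3 * (q ^ (2 * L)) ^ 3 ≠ 0 := by
      rw [← pow_mul, ← pow_add]; exact one_add_q_pow_ne_zero (by omega)
    have hn' : 1 + q ^ 3 * (q ^ (2 * L + 1)) ^ 3 ≠ 0 := by
      rw [← pow_mul, ← pow_add]; exact one_add_q_pow_ne_zero (by omega)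
    have key : q ^ (L + 1) ^ 2 * truncGaussSum (2 * L + 2) = (-1) ^ (L + 1) := by
      rw [show q ^ (L + 1) ^ 2 = q ^ L ^ 2 * q ^ (2 * L) * q by ring,
        pow_succ (-1 : RatFunc ℚ)]
      apply mul_left_cancel₀ hn
      linear_combination q ^ L ^ 2 * hr + q * (q ^ (2 * L)) ^ 2 * (1 - q ^ 3) * ho -
        (1 + q ^ 6 * (q ^ (2 * L)) ^ 3) * he
    refine ⟨key, ?_⟩
    rw [show 2 * (L + 1) + 1 = 2 * L + 1 + 2 by ring]
    rw [show 2 * L + 1 + 1 = 2 * L + 2 by ring] at hr'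
    rw [show q ^ (L + 1) ^ 2 = q ^ L ^ 2 * q ^ (2 * L) * q by ring,
      pow_succ (-1 : RatFunc ℚ)] at key ⊢
    apply mul_left_cancel₀ (mul_ne_zero hq hn')
    linear_combination q ^ L ^ 2 * hr' + q ^ 2 * q ^ (2 * L) * (1 - q ^ 3) * key -
      (1 + q ^ 6 * (q ^ (2 * L + 1)) ^ 3) * ho

lemma summand_eq_gaussTerm {L i : ℕ} (hi : i ≤ 2 * L) :
    (-1 : RatFunc ℚ) ^ ((L : ℤ) - i) * q ^ (((L : ℤ) - i) ^ 2) *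
        qPochZ (-q) ((L : ℤ) - (L - i)) *
        qbinom (3 * (L : ℤ) - (L - i) + 1) ((L : ℤ) + (L - i)) *
        ((1 - q ^ (4 * (L : ℤ) + 1)) / (1 - q ^ (3 * (L : ℤ) - (L - i) + 1))) =
      (-1) ^ L * q ^ L ^ 2 * ((1 - q * (q ^ (2 * L)) ^ 2) * gaussTerm (2 * L) i) := by
  obtain ⟨d, hd⟩ := Nat.exists_eq_add_of_le hi
  have hq := q_ne_zero
  have e1 : (L : ℤ) - (L - i) = (i : ℕ) := by ring
  have e2 : 3 * (L : ℤ) - (L - i) + 1 = (2 * L + i + 1 : ℕ) := by push_cast; ring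
  have e3 : (L : ℤ) + (L - i) = (d : ℕ) := by omega
  have e4 : 4 * (L : ℤ) + 1 = (4 * L + 1 : ℕ) := by push_cast; ring
  have e5 : ((2 * L + i + 1 : ℕ) : ℤ) - (d : ℕ) = (2 * i + 1 : ℕ) := by omega
  have e6 : q ^ (((L : ℤ) - i) ^ 2) = q ^ L ^ 2 * q ^ i ^ 2 / q ^ (2 * L * i) := by
    rw [eq_div_iff (pow_ne_zero _ hq), ← zpow_natCast q (2 * L * i), ← zpow_natCast q (L ^ 2),
      ← zpow_natCast q (i ^ 2), ← zpow_add₀ hq, ← zpow_add₀ hq]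
    congr 1; push_cast; ring
  have e7 : (-1 : RatFunc ℚ) ^ ((L : ℤ) - i) = (-1) ^ L * (-1) ^ (2 * L + i) := by
    rw [zpow_sub₀ (by norm_num), zpow_natCast, zpow_natCast, pow_add, pow_mul]
    rcases Nat.even_or_odd i with h | h <;> simp [h.neg_one_pow, div_neg]
  rw [e1, e2, e3, e4, e6, e7, qPochZ, if_pos (by omega), qbinom, if_pos (by omega), e5,
    gaussTerm, if_pos hi, show 2 * L - i = d by omega]
  simp only [Int.toNat_natCast, zpow_natCast]
  have hneg : qPoch (-q) i ≠ 0 := by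
    intro h
    apply qPoch_q_ne_zero (2 * i + 1)
    rw [qPoch_two_mul_add_one, h]; ring
  rw [qPoch_q_succ (2 * L + i), qPoch_two_mul_add_one,
    show q ^ (4 * L + 1) = q * (q ^ (2 * L)) ^ 2 by ring]
  have := one_sub_q_pow_ne_zero (n := 2 * L + i + 1) (by omega)
  have := qPoch_q_ne_zero d
  have := qPoch_q_ne_zero i
  have := oddPoch_ne_zero (i + 1)
  have : q ^ (2 * L * i) ≠ 0 := pow_ne_zero _ hq
  generalize q ^ (2 * L * i) = u at *
  generalize q ^ (2 * L + i + 1) = v at *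
  generalize q ^ (2 * L) = x at *
  generalize q ^ i ^ 2 = w at *
  generalize q ^ L ^ 2 = y at *
  field_simp

/-- Theorem 2.4: a truncation of Gauss' square exponent theorem. -/
theorem truncated_gauss_sq_exponent_two (L : ℕ) (hL : 1 ≤ L) :
    ∑ k ∈ Finset.Icc (-(L : ℤ)) (L : ℤ),
      (-1 : RatFunc ℚ) ^ k * q ^ (k ^ 2) * qPochZ (-q) ((L : ℤ) - k) *
        qbinom (3 * (L : ℤ) - k + 1) ((L : ℤ) + k) *
        ((1 - q ^ (4 * (L : ℤ) + 1)) / (1 - q ^ (3 * (L : ℤ) - k + 1))) = 1 := by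
  have hsum : (-1) ^ L * q ^ L ^ 2 * truncGaussSum (2 * L) = 1 := by
    rw [mul_assoc, (truncGaussSum_values L).1, ← mul_pow]
    norm_num
  refine Eq.trans ?_ hsum
  rw [truncGaussSum, Finset.mul_sum]
  symm
  refine Finset.sum_nbij' (fun i : ℕ => (L : ℤ) - i) (fun k : ℤ => ((L : ℤ) - k).toNat)
    ?_ ?_ ?_ ?_ ?_
  · intro i hi
    rw [Finset.mem_range] at hi
    rw [Finset.mem_Icc]
    omega
  · intro k hk
    rw [Finset.mem_Icc] at hk
    rw [Finset.mem_range]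
    omega
  · intro i _
    simp
  · intro k hk
    rw [Finset.mem_Icc] at hk
    omega
  · intro i hi
    rw [Finset.mem_range] at hi
    exact (summand_eq_gaussTerm (Nat.lt_succ_iff.mp hi)).symm
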